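/- Let k and u₀ be real. There exist constants T₁ and C > 0 such that for every T ≥ T₁ there is a unique u_T ≥ u₀ with V_k(u_T) = T and V_k(u) < T for u₀ ≤ u < u_T, and the integral I(T) = ∫_{u₀}^{u_T} √(T − V_k(u)) du satisfies |I(T) − ((1/2)·√T·log T + (2·log 2 − 1 − u₀)·√T)| ≤ C. -/

import Mathlib

/-- The Morse potential `V_k(u) = (1/4)·exp(2u) + k·exp(u)`. -/
noncomputable def morse (k u : ℝ) : ℝ := (1/4) * Real.exp (2*u) + k * Real.exp u

lemma log_diff_aux {A B T : ℝ} (hT : 0 < T) (hA : T ≤ A) (hB : T ≤ B) :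
    |Real.log A - Real.log B| ≤ |A - B| / T := by
  have key : ∀ A B : ℝ, T ≤ A → T ≤ B → Real.log A - Real.log B ≤ |A - B| / T := by
    intro A B hA hB
    have hA0 : 0 < A := by linarith
    have hB0 : 0 < B := by linarith
    rw [← Real.log_div hA0.ne' hB0.ne']
    have h1 := Real.log_le_sub_one_of_pos (div_pos hA0 hB0)
    have h2 : A / B - 1 = (A - B) / B := by field_simp
    have h3 : (A - B) / B ≤ |A - B| / B := by gcongr; exact le_abs_self _
    have h4 : |A - B| / B ≤ |A - B| / T := by gcongr
    linarith
  rw [abs_le]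
  have h1 := key A B hA hB
  have h2 := key B A hB hA
  rw [abs_sub_comm B A] at h2
  constructor <;> linarith

lemma morse_eq (k u : ℝ) : morse k u = (Real.exp u)^2/4 + k * Real.exp u := by
  unfold morse
  rw [two_mul, Real.exp_add]; ring

noncomputable def primF (k T u : ℝ) : ℝ :=
  Real.sqrt (T - morse k u)
    - k * Real.arcsin ((Real.exp u / 2 + k) / Real.sqrt (T + k^2))
    - Real.sqrt T * (Real.log (2 * Real.sqrt T * Real.sqrt (T - morse k u)
        - k * Real.exp u + 2 * T) - u)

lemma arg_ge {k T u : ℝ} (h : morse k u ≤ T) :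
    T ≤ 2 * Real.sqrt T * Real.sqrt (T - morse k u) - k * Real.exp u + 2 * T := by
  rw [morse_eq] at h
  have : 0 ≤ 2 * Real.sqrt T * Real.sqrt (T - morse k u) := by positivity
  nlinarith [sq_nonneg (Real.exp u)]

lemma primF_deriv {k T u : ℝ} (hT : 0 < T) (h : morse k u < T) :
    HasDerivAt (primF k T) (Real.sqrt (T - morse k u)) u := by
  have hx := Real.hasDerivAt_exp u
  have hx0 := Real.exp_pos u
  have hQ : 0 < T - morse k u := by linarith
  have hm : HasDerivAt (fun u => T - morse k u)
      (-((Real.exp u)^2/2 + k * Real.exp u)) u := by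
    have e : (fun u => T - morse k u) = fun u => T - ((Real.exp u)^2/4 + k * Real.exp u) := by
      funext y; rw [morse_eq]
    rw [e]
    have := (((hx.pow 2).div_const 4).add (hx.const_mul k)).const_sub T
    have e2 : -((Real.exp u)^2/2 + k * Real.exp u)
        = -(((2:ℕ):ℝ) * Real.exp u ^ (2 - 1) * Real.exp u / 4 + k * Real.exp u) := by
      norm_num; ring
    rw [e2]
    exact this
  have hq := hm.sqrt hQ.ne'
  have hA := arg_ge h.le
  have hApos : 0 < 2 * Real.sqrt T * Real.sqrt (T - morse k u) - k * Real.exp u + 2 * T := by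
    linarith
  have hlog := ((((hq.const_mul (2 * Real.sqrt T)).sub (hx.const_mul k)).add_const (2*T)).log
    hApos.ne')
  have hS2 : 0 < T + k^2 := by positivity
  have hSpos := Real.sqrt_pos.mpr hS2
  have hSsq := Real.sq_sqrt hS2.le
  have hqpos := Real.sqrt_pos.mpr hQ
  have hqsq := Real.sq_sqrt hQ.le
  have hspos := Real.sqrt_pos.mpr hT
  have hssq := Real.sq_sqrt hT.le
  have hw : 1 - ((Real.exp u / 2 + k) / Real.sqrt (T + k^2))^2
      = (Real.sqrt (T - morse k u) / Real.sqrt (T + k^2))^2 := by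
    rw [div_pow, div_pow, hqsq, hSsq, morse_eq]
    field_simp; ring
  have hwpos : 0 < 1 - ((Real.exp u / 2 + k) / Real.sqrt (T + k^2))^2 := by
    rw [hw]; positivity
  have hwlt := (sq_lt_one_iff_abs_lt_one _).mp (by linarith : ((Real.exp u / 2 + k) / Real.sqrt (T + k^2))^2 < 1)
  rw [abs_lt] at hwlt
  have hin : HasDerivAt (fun u => (Real.exp u / 2 + k) / Real.sqrt (T + k^2))
      (Real.exp u / 2 / Real.sqrt (T + k^2)) u :=
    ((hx.div_const 2).add_const k).div_const _
  have has := (Real.hasDerivAt_arcsin hwlt.1.ne' hwlt.2.ne).comp u hin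
  rw [hw, Real.sqrt_sq (by positivity)] at has
  have tot := (hq.sub (has.const_mul k)).sub
    ((hlog.sub (hasDerivAt_id u)).const_mul (Real.sqrt T))
  have hfun : HasDerivAt (primF k T) _ u := tot
  convert hfun using 1
  have hqq : Real.sqrt (T - morse k u)^2 = Real.sqrt T^2 - ((Real.exp u)^2/4 + k * Real.exp u) := by
    rw [hqsq, hssq, morse_eq]
  have hApos' : 0 < 2 * Real.sqrt T * Real.sqrt (T - morse k u) - k * Real.exp u
      + 2 * Real.sqrt T^2 := by rw [hssq]; exact hApos
  simp only [Pi.sub_apply]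
  generalize Real.sqrt (T - morse k u) = q at *
  generalize Real.sqrt (T + k^2) = S at *
  generalize Real.exp u = x at *
  generalize Real.sqrt T = s at *
  subst hssq
  have h1 : 2 * s * q - k * x + 2 * s^2 ≠ 0 := hApos.ne'
  have h2 : 1 / (q / S) * (x / 2 / S) = x / (2 * q) := by field_simp
  rw [h2]
  have h3 : (2 * s * (-(x ^ 2 / 2 + k * x) / (2 * q)) - k * x) / (2 * s * q - k * x + 2 * s ^ 2)
      = 1 - s / q := by
    rw [div_eq_iff h1]
    have e1 : 2 * s * (-(x ^ 2 / 2 + k * x) / (2 * q)) - k * x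
        = (-(s * (x ^ 2 / 2 + k * x)) - k * x * q) / q := by
      field_simp
    have e2 : (1 - s / q) * (2 * s * q - k * x + 2 * s ^ 2)
        = ((q - s) * (2 * s * q - k * x + 2 * s ^ 2)) / q := by
      field_simp
    rw [e1, e2]
    congr 1
    linear_combination (-2 * s) * hqq
  rw [h3]
  have e3 : -(x ^ 2 / 2 + k * x) / (2 * q) - k * (x / (2 * q)) - s * (1 - s / q - 1)
      = (-(x ^ 2 / 4 + k * x) + s ^ 2) / q := by
    field_simp
    ring
  rw [e3, eq_div_iff hqpos.ne']
  linear_combination hqq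

lemma primF_cont {k T a b : ℝ} (hT : 0 < T) (h : ∀ u ∈ Set.Icc a b, morse k u ≤ T) :
    ContinuousOn (primF k T) (Set.Icc a b) := by
  have hm : Continuous (morse k) := by unfold morse; fun_prop
  unfold primF
  refine ContinuousOn.sub (Continuous.continuousOn (by fun_prop)) ?_
  refine ContinuousOn.mul continuousOn_const (ContinuousOn.sub ?_ continuousOn_id)
  refine ContinuousOn.log (Continuous.continuousOn (by fun_prop)) ?_
  intro u hu
  have := arg_ge (h u hu)
  linarith

/-- Asymptotics of the phase-space integral for the Morse potential:
`∫_{u₀}^{u_T} √(T - V_k(u)) du = (1/2)·√T·log T + (2 log 2 - 1 - u₀)·√T + O(1)`. -/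
theorem stmt_10 (k u₀ : ℝ) :
    ∃ T₁ C : ℝ, 0 < C ∧ ∀ T : ℝ, T₁ ≤ T →
      ∃ uT : ℝ, (u₀ ≤ uT ∧ morse k uT = T ∧ ∀ u : ℝ, u₀ ≤ u → u < uT → morse k u < T) ∧
        (∀ u' : ℝ, (u₀ ≤ u' ∧ morse k u' = T ∧ ∀ u : ℝ, u₀ ≤ u → u < u' → morse k u < T) → u' = uT) ∧
        |(∫ u in u₀..uT, Real.sqrt (T - morse k u)) -
          ((1/2) * Real.sqrt T * Real.log T + (2*Real.log 2 - 1 - u₀) * Real.sqrt T)| ≤ C := by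
  refine ⟨(1 + |k| + Real.exp u₀)^2, |k| * Real.pi + k^2/2 + |morse k u₀| +
    (2 * |morse k u₀| + |k| * Real.exp u₀) + 1, ?_, ?_⟩
  · have := Real.pi_pos
    positivity
  intro T hT1
  have hx0 := Real.exp_pos u₀
  have hk0 := abs_nonneg k
  have hs : 1 + |k| + Real.exp u₀ ≤ Real.sqrt T := Real.le_sqrt_of_sq_le hT1
  have hT : 0 < T := lt_of_lt_of_le (by positivity) hT1
  have hS2 : 0 < T + k^2 := by positivity
  have hssq := Real.sq_sqrt hT.le
  have hSsq := Real.sq_sqrt hS2.le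
  have hsS : Real.sqrt T ≤ Real.sqrt (T + k^2) := Real.sqrt_le_sqrt (by nlinarith [sq_nonneg k])
  set s := Real.sqrt T with hsdef
  set S := Real.sqrt (T + k^2) with hSdef
  have hk1 := le_abs_self k
  have hk2 := neg_abs_le k
  have hs1 : 1 ≤ s := by linarith
  have hX : 0 < 2 * (S - k) := by linarith
  have hexp : Real.exp (Real.log (2 * (S - k))) = 2 * (S - k) := Real.exp_log hX
  obtain ⟨uT, huT⟩ : ∃ uT, uT = Real.log (2 * (S - k)) := ⟨_, rfl⟩
  rw [← huT] at hexp
  have hle : u₀ ≤ uT := by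
    rw [← Real.exp_le_exp, hexp]; linarith
  have hVT : morse k uT = T := by
    rw [morse_eq, hexp]; nlinarith
  have hlt : ∀ u, u < uT → morse k u < T := by
    intro u hu
    have h1 : Real.exp u < 2 * (S - k) := by rw [← hexp]; exact Real.exp_lt_exp.mpr hu
    have h2 := Real.exp_pos u
    rw [morse_eq]
    have : 0 < (S - Real.exp u / 2 - k) * (S + Real.exp u / 2 + k) :=
      mul_pos (by linarith) (by linarith)
    nlinarith
  refine ⟨uT, ⟨hle, hVT, fun u _ h => hlt u h⟩, ?_, ?_⟩
  · rintro u' ⟨h1, h2, h3⟩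
    rcases lt_trichotomy u' uT with h | h | h
    · have := hlt u' h; linarith
    · exact h
    · have := h3 uT hle h; linarith
  have hle' : ∀ u, u ≤ uT → morse k u ≤ T := by
    intro u hu
    rcases hu.lt_or_eq with h | h
    · exact (hlt u h).le
    · rw [h, hVT]
  have hm : Continuous (morse k) := by unfold morse; fun_prop
  have hint := intervalIntegral.integral_eq_sub_of_hasDerivAt_of_le hle
    (primF_cont hT (fun u hu => hle' u hu.2))
    (fun u hu => primF_deriv hT (hlt u hu.2))
    (Continuous.intervalIntegrable (by fun_prop) _ _)
  rw [hint]
  have hFT : primF k T uT = - k * (Real.pi / 2) - s * Real.log S := by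
    have hSp : 0 < S := by linarith
    unfold primF
    rw [hVT, sub_self, Real.sqrt_zero, hexp, ← hSdef, ← hsdef]
    have e1 : (2 * (S - k) / 2 + k) / S = 1 := by field_simp; ring
    have e2 : 2 * s * 0 - k * (2 * (S - k)) + 2 * T = S * (2 * (S - k)) := by nlinarith
    rw [e1, e2, Real.arcsin_one, Real.log_mul hSp.ne' hX.ne', huT]
    ring
  have hF0 : primF k T u₀ = Real.sqrt (T - morse k u₀)
    - k * Real.arcsin ((Real.exp u₀ / 2 + k) / S)
    - s * (Real.log (2 * s * Real.sqrt (T - morse k u₀)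
        - k * Real.exp u₀ + 2 * T) - u₀) := rfl
  rw [hFT, hF0]
  have hA := arg_ge (hle' u₀ hle)
  rw [← hsdef] at hA
  have hr0 := Real.sqrt_nonneg (T - morse k u₀)
  have hrsq := Real.sq_sqrt (sub_nonneg.mpr (hle' u₀ hle))
  set r := Real.sqrt (T - morse k u₀) with hr
  set v := morse k u₀
  set A := 2 * s * r - k * Real.exp u₀ + 2 * T with hAdef
  set θ := Real.arcsin ((Real.exp u₀ / 2 + k) / S)
  have e_v : v = (s - r) * (s + r) := by linear_combination hrsq - hssq
  have hθ1 : |θ| ≤ Real.pi / 2 := abs_le.mpr ⟨Real.neg_pi_div_two_le_arcsin _, Real.arcsin_le_pi_div_two _⟩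
  have b1 : |k * θ| ≤ |k| * (Real.pi / 2) := by rw [abs_mul]; gcongr
  have b1' : |k * (Real.pi / 2)| = |k| * (Real.pi / 2) := by
    rw [abs_mul, abs_of_pos (by positivity : 0 < Real.pi / 2)]
  have b2s : s * |s - r| ≤ |v| := by
    rw [e_v, abs_mul, abs_of_pos (by linarith : 0 < s + r)]
    rw [mul_comm]
    exact mul_le_mul_of_nonneg_left (by linarith) (abs_nonneg _)
  have b2 : |s - r| ≤ |v| := (le_mul_of_one_le_left (abs_nonneg _) hs1).trans b2s
  have hlogT : Real.log T = 2 * Real.log s := by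
    rw [← hssq, Real.log_pow]; norm_num
  have hlogS : Real.log (T + k^2) = 2 * Real.log S := by
    rw [← hSsq, Real.log_pow]; norm_num
  have red : ∀ Y, 0 ≤ Y → s * (Y / T) ≤ Y := by
    intro Y hY
    rw [← mul_div_assoc, div_le_iff₀ hT, ← hssq]
    have : s ≤ s^2 := le_self_pow₀ hs1 (by norm_num)
    rw [mul_comm]
    exact mul_le_mul_of_nonneg_left this hY
  have b3 : |s * (Real.log (T + k^2) - Real.log T)| ≤ k^2 := by
    have h := log_diff_aux hT (by nlinarith [sq_nonneg k] : T ≤ T + k^2) le_rfl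
    rw [add_sub_cancel_left, abs_of_nonneg (sq_nonneg k)] at h
    rw [abs_mul, abs_of_pos (by linarith : 0 < s)]
    exact (mul_le_mul_of_nonneg_left h (by linarith)).trans (red _ (sq_nonneg k))
  have hlog4 : Real.log (4 * T) = 2 * Real.log 2 + Real.log T := by
    rw [Real.log_mul (by norm_num) hT.ne', show (4:ℝ) = 2^2 by norm_num, Real.log_pow]; norm_num
  have b4 : |s * (Real.log A - Real.log (4 * T))| ≤ 2 * |v| + |k| * Real.exp u₀ := by
    have h := log_diff_aux hT hA (by linarith : T ≤ 4 * T)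
    have hd : |A - 4 * T| ≤ 2 * |v| + |k| * Real.exp u₀ := by
      have e : A - 4 * T = -(2 * (s * (s - r))) - k * Real.exp u₀ := by
        rw [hAdef]; linear_combination 2 * hssq
      rw [e]
      refine (abs_sub _ _).trans ?_
      rw [abs_neg, abs_mul, abs_mul, abs_mul, abs_of_pos (by linarith : 0 < s), abs_of_pos hx0,
        abs_of_pos (by norm_num : (0:ℝ) < 2)]
      linarith
    rw [abs_mul, abs_of_pos (by linarith : 0 < s)]
    exact ((mul_le_mul_of_nonneg_left h (by linarith)).trans (red _ (abs_nonneg _))).trans hd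
  have fin : -k * (Real.pi / 2) - s * Real.log S - (r - k * θ - s * (Real.log A - u₀)) -
      (1 / 2 * s * Real.log T + (2 * Real.log 2 - 1 - u₀) * s) =
      - (k * (Real.pi / 2)) + k * θ + (s - r) - (1/2) * (s * (Real.log (T + k^2) - Real.log T))
       + s * (Real.log A - Real.log (4 * T)) := by
    rw [hlog4, hlogS, hlogT]; ring
  rw [fin, abs_le]
  rw [abs_le] at b1 b2 b3 b4
  have c1 := le_abs_self (k * (Real.pi/2))
  have c2 := neg_abs_le (k * (Real.pi/2))
  rw [b1'] at c1 c2
  constructor <;> linarith [b1.1, b1.2, b2.1, b2.2, b3.1, b3.2, b4.1, b4.2]
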